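/- For every n ≥ 1, the complex matrix M₂ of the duality symmetry U₂₂ satisfies M₂† · M₂ = (1/2)(I − F), where M₂† is the conjugate transpose, I is the identity matrix, and F is the permutation matrix of the componentwise flip on antiperiodic binary strings. (This is the unitarity of U₂₂ on the physical, flip-antisymmetric subspace.) -/

import Mathlib

open Matrix

instance (n : ℕ) [NeZero n] : NeZero (2 * n) :=
  ⟨Nat.mul_ne_zero two_ne_zero (NeZero.ne n)⟩

/-- Antiperiodic binary strings on `ℤ/2n`: `μ : ℤ/2n → {0,1}` with `μ(i+n) = 1 − μ(i)`. -/
abbrev APString (n : ℕ) [NeZero n] :=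
  {μ : ZMod (2 * n) → Fin 2 // ∀ i, μ (i + (n : ZMod (2 * n))) = 1 - μ i}

/-- `E_{2n}(μ,ν) = Σ_{i ∈ ℤ/2n} μ(i)·(ν(i+1) − ν(i))`. -/
def Emat (n : ℕ) [NeZero n] (μ ν : APString n) : ℤ :=
  ∑ i : ZMod (2 * n),
    ((μ.1 i : ℕ) : ℤ) * (((ν.1 (i + 1) : ℕ) : ℤ) - ((ν.1 i : ℕ) : ℤ))

/-- The complex matrix `M₂` of the duality symmetry `U₂₂`, with entries
`M₂(ν,μ) = 2^{−(n+1)/2}·i^{E_{2n}(μ,ν)}`, indexed by antiperiodic binary strings. -/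
noncomputable def M2 (n : ℕ) [NeZero n] : Matrix (APString n) (APString n) ℂ :=
  fun ν μ => (((2 : ℝ) ^ (-(((n : ℝ) + 1) / 2)) : ℝ) : ℂ) * Complex.I ^ Emat n μ ν

/-- The permutation matrix `F` of the componentwise flip `μ ↦ 1−μ` on antiperiodic
binary strings. -/
def flipMat (n : ℕ) [NeZero n] : Matrix (APString n) (APString n) ℂ :=
  fun ρ μ => if ρ.1 = (fun i => 1 - μ.1 i) then 1 else 0

theorem ZMod.natCast_add_natCast_self_two_mul (n : ℕ) :
    (n : ZMod (2 * n)) + (n : ZMod (2 * n)) = 0 := by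
  have h := ZMod.natCast_self (2 * n)
  push_cast at h
  linear_combination h

theorem ZMod.natCast_ne_zero_two_mul (n : ℕ) [NeZero n] : (n : ZMod (2 * n)) ≠ 0 := by
  rw [Ne, ZMod.natCast_eq_zero_iff]
  intro h
  have := Nat.le_of_dvd (NeZero.pos n) h
  have := NeZero.pos n
  omega

theorem ZMod.sum_two_mul {M : Type*} [AddCommMonoid M] (n : ℕ) [NeZero n]
    (f : ZMod (2 * n) → M) :
    ∑ i, f i = ∑ k ∈ Finset.range n, (f k + f (k + n)) := by
  have h : ∑ i, f i = ∑ k ∈ Finset.range (2 * n), f (k : ZMod (2 * n)) := by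
    refine Finset.sum_bij' (fun i _ => i.val) (fun k _ => (k : ZMod (2 * n))) ?_ ?_ ?_ ?_ ?_
    · intro i _
      exact Finset.mem_range.2 (ZMod.val_lt i)
    · simp
    · intro i _
      exact ZMod.natCast_zmod_val i
    · intro k hk
      exact ZMod.val_cast_of_lt (Finset.mem_range.1 hk)
    · intro i _
      rw [ZMod.natCast_zmod_val]
  rw [h, Finset.sum_congr (congrArg Finset.range (two_mul n)) fun _ _ => rfl,
    Finset.sum_range_add, Finset.sum_add_distrib]
  congr 1
  refine Finset.sum_congr rfl fun k _ => ?_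
  push_cast
  rw [add_comm]

theorem ZMod.eq_of_forall_add_one {α : Type*} {m : ℕ} [NeZero m] {f : ZMod m → α}
    (h : ∀ i, f (i + 1) = f i) (i : ZMod m) : f i = f 0 := by
  have key : ∀ k : ℕ, f k = f 0 := by
    intro k
    induction k with
    | zero => simp
    | succ k ih => rw [Nat.cast_succ, h, ih]
  rw [← ZMod.natCast_zmod_val i, key]

theorem Fin.intCast_val_one_sub (a : Fin 2) : (((1 - a : Fin 2) : ℕ) : ℤ) = 1 - ((a : ℕ) : ℤ) := by
  fin_cases a <;> rfl

theorem Fin.one_sub_one_sub (a : Fin 2) : 1 - (1 - a) = a := by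
  fin_cases a <;> rfl

namespace APString

variable {n : ℕ} [NeZero n]

/-- The value of an antiperiodic string at a site, as an integer. -/
def val (μ : APString n) (i : ZMod (2 * n)) : ℤ := ((μ.1 i : ℕ) : ℤ)

theorem val_eq_zero_or_one (μ : APString n) (i : ZMod (2 * n)) : μ.val i = 0 ∨ μ.val i = 1 := by
  have := (μ.1 i).isLt
  unfold val
  omega

theorem val_add_natCast (μ : APString n) (i : ZMod (2 * n)) :
    μ.val (i + n) = 1 - μ.val i := by
  unfold val
  rw [μ.2, Fin.intCast_val_one_sub]

theorem val_injective : Function.Injective (val : APString n → ZMod (2 * n) → ℤ) := by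
  intro μ ν h
  refine Subtype.ext (funext fun i => Fin.ext ?_)
  have := congrFun h i
  unfold val at this
  exact_mod_cast this

/-- The componentwise flip `μ ↦ 1 - μ`. -/
def flip (μ : APString n) : APString n :=
  ⟨fun i => 1 - μ.1 i, fun i => congrArg (1 - ·) (μ.2 i)⟩

theorem val_flip (μ : APString n) (i : ZMod (2 * n)) : μ.flip.val i = 1 - μ.val i :=
  Fin.intCast_val_one_sub _

theorem flip_ne_self (μ : APString n) : μ.flip ≠ μ := by
  intro h
  have h1 := val_flip μ 0
  rw [h] at h1
  omega

/-- Flipping a string at the antipodal sites `j` and `j + n`. -/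
def flipAt (j : ZMod (2 * n)) (ν : APString n) : APString n :=
  ⟨fun i => if i = j ∨ i = j + n then 1 - ν.1 i else ν.1 i, fun i => by
    have hn := ZMod.natCast_add_natCast_self_two_mul n
    have h1 : i + n = j ↔ i = j + n :=
      ⟨fun h => by linear_combination h - hn, fun h => by linear_combination h + hn⟩
    have h2 : (i + n = j ∨ i + n = j + n) ↔ (i = j ∨ i = j + n) := by
      rw [h1, add_left_inj, or_comm]
    simp only [h2, ν.2]
    split_ifs <;> rfl⟩

theorem flipAt_involutive (j : ZMod (2 * n)) :
    Function.Involutive (flipAt j : APString n → APString n) := by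
  intro ν
  refine Subtype.ext (funext fun i => ?_)
  simp only [flipAt]
  split_ifs
  · exact Fin.one_sub_one_sub _
  · rfl

theorem val_flipAt_sub (j i : ZMod (2 * n)) (ν : APString n) :
    (flipAt j ν).val i - ν.val i =
      (if i = j then 1 - 2 * ν.val j else 0) + (if i = j + n then -(1 - 2 * ν.val j) else 0) := by
  have hj : j ≠ j + n := fun h => ZMod.natCast_ne_zero_two_mul n (left_eq_add.1 h)
  have hadd := ν.val_add_natCast j
  have hval : (flipAt j ν).val i = if i = j ∨ i = j + n then 1 - ν.val i else ν.val i := by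
    simp only [flipAt, val]
    split_ifs
    · exact Fin.intCast_val_one_sub _
    · rfl
  rw [hval]
  by_cases h1 : i = j
  · subst h1
    simp only [true_or, if_true, if_neg hj]
    ring
  · by_cases h2 : i = j + n
    · subst h2
      simp only [or_true, if_true, if_neg h1, hadd]
      ring
    · simp [h1, h2]

/-- An antiperiodic string is determined by its restriction to `{0, …, n - 1}`. -/
theorem card : Fintype.card (APString n) = 2 ^ n := by
  have hlt : ∀ k : Fin n, ((k : ℕ) : ZMod (2 * n)).val = k := fun k =>
    ZMod.val_cast_of_lt (by omega)
  have hb : Function.Bijective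
      (fun (μ : APString n) (k : Fin n) => μ.1 ((k : ℕ) : ZMod (2 * n))) := by
    constructor
    · intro μ ν h
      refine Subtype.ext (funext fun i => ?_)
      have hi := ZMod.val_lt i
      have hcast := ZMod.natCast_zmod_val i
      by_cases hin : i.val < n
      · have := congrFun h ⟨i.val, hin⟩
        simpa [hcast] using this
      · have := congrFun h ⟨i.val - n, by omega⟩
        have hs : i = ((i.val - n : ℕ) : ZMod (2 * n)) + n := by
          rw [← Nat.cast_add, Nat.sub_add_cancel (by omega), hcast]
        rw [hs, μ.2, ν.2]
        exact congrArg (1 - ·) this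
    · intro g
      refine ⟨⟨fun i => if h : i.val < n then g ⟨i.val, h⟩
        else 1 - g ⟨i.val - n, by have := ZMod.val_lt i; omega⟩, fun i => ?_⟩, ?_⟩
      · have hi := ZMod.val_lt i
        have hn := NeZero.pos n
        have hnv : ((n : ℕ) : ZMod (2 * n)).val = n := ZMod.val_cast_of_lt (by omega)
        by_cases hin : i.val < n
        · have hv : (i + n).val = i.val + n := by
            rw [ZMod.val_add_of_lt (by omega), hnv]
          simp [hv, hin]
        · have hv : (i + n).val = i.val - n := by
            have := ZMod.val_add_val_of_le (a := i) (b := n) (by omega)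
            omega
          have hin' : i.val - n < n := by omega
          simp [hv, hin, hin']
      · funext k
        simp [hlt]
  rw [Fintype.card_of_bijective hb]
  simp

end APString

section Emat

variable {n : ℕ} [NeZero n]

theorem Emat_eq_sum_sub_mul (μ ν : APString n) :
    Emat n μ ν = ∑ i, (μ.val (i - 1) - μ.val i) * ν.val i := by
  have h : ∑ i, μ.val i * ν.val (i + 1) = ∑ i, μ.val (i - 1) * ν.val i :=
    Fintype.sum_equiv (Equiv.addRight 1) _ _ (by simp)
  change ∑ i, μ.val i * (ν.val (i + 1) - ν.val i) = _
  simp only [mul_sub, sub_mul, Finset.sum_sub_distrib, h]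

theorem Emat_flipAt_sub (μ ν : APString n) (j : ZMod (2 * n)) :
    Emat n μ (ν.flipAt j) - Emat n μ ν =
      2 * (1 - 2 * ν.val j) * (μ.val (j - 1) - μ.val j) := by
  rw [Emat_eq_sum_sub_mul, Emat_eq_sum_sub_mul, ← Finset.sum_sub_distrib]
  simp only [← mul_sub, APString.val_flipAt_sub, mul_add, Finset.sum_add_distrib, mul_ite,
    mul_zero, Finset.sum_ite_eq', Finset.mem_univ, if_true]
  rw [add_sub_right_comm, APString.val_add_natCast, APString.val_add_natCast]
  ring

theorem Emat_flip (μ ν : APString n) : Emat n μ.flip ν = -Emat n μ ν := by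
  rw [Emat_eq_sum_sub_mul, Emat_eq_sum_sub_mul, ← Finset.sum_neg_distrib]
  refine Finset.sum_congr rfl fun i _ => ?_
  rw [APString.val_flip, APString.val_flip]
  ring

theorem odd_Emat (μ ν : APString n) : Odd (Emat n μ ν) := by
  have h : Emat n μ ν = ∑ k ∈ Finset.range n, (2 * μ.val k - 1) * (ν.val (k + 1) - ν.val k) := by
    change ∑ i, μ.val i * (ν.val (i + 1) - ν.val i) = _
    rw [ZMod.sum_two_mul]
    refine Finset.sum_congr rfl fun k _ => ?_
    rw [add_right_comm, APString.val_add_natCast, APString.val_add_natCast,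
      APString.val_add_natCast]
    ring
  have ht : ∑ k ∈ Finset.range n, (ν.val ((k : ZMod (2 * n)) + 1) - ν.val k) =
      1 - 2 * ν.val 0 := by
    have := Finset.sum_range_sub (fun k : ℕ => ν.val (k : ZMod (2 * n))) n
    have h0 := ν.val_add_natCast 0
    rw [zero_add] at h0
    push_cast at this
    rw [this, h0]
    ring
  have h2 : Emat n μ ν = 2 * ∑ k ∈ Finset.range n, (μ.val k - 1) * (ν.val (k + 1) - ν.val k)
      + (1 - 2 * ν.val 0) := by
    rw [h, ← ht, Finset.mul_sum, ← Finset.sum_add_distrib]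
    exact Finset.sum_congr rfl fun k _ => by ring
  rw [h2]
  exact (even_two_mul _).add_odd ⟨-ν.val 0, by ring⟩

theorem exists_odd_sub_of_ne {ρ μ : APString n} (h1 : ρ ≠ μ) (h2 : ρ ≠ μ.flip) :
    ∃ j, Odd ((μ.val (j - 1) - μ.val j) - (ρ.val (j - 1) - ρ.val j)) := by
  by_contra! H
  have hc : ∀ i, (μ.val i - ρ.val i) % 2 = (μ.val 0 - ρ.val 0) % 2 := by
    refine ZMod.eq_of_forall_add_one (f := fun i => (μ.val i - ρ.val i) % 2) fun i => ?_
    have h := H (i + 1)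
    rw [Int.not_odd_iff, add_sub_cancel_right] at h
    omega
  rcases Int.emod_two_eq_zero_or_one (μ.val 0 - ρ.val 0) with h0 | h0
  · refine h1 (APString.val_injective (funext fun i => ?_))
    have := hc i
    have := μ.val_eq_zero_or_one i
    have := ρ.val_eq_zero_or_one i
    omega
  · refine h2 (APString.val_injective (funext fun i => ?_))
    have := hc i
    have := μ.val_eq_zero_or_one i
    have := ρ.val_eq_zero_or_one i
    rw [APString.val_flip]
    omega

end Emat

theorem Complex.I_zpow_two_mul_of_odd {k : ℤ} (hk : Odd k) : Complex.I ^ (2 * k) = -1 := by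
  rw [_root_.zpow_mul]
  have : Complex.I ^ (2 : ℤ) = -1 := by
    rw [zpow_ofNat, Complex.I_sq]
  rw [this, hk.neg_one_zpow]

theorem sum_I_zpow_Emat_sub {n : ℕ} [NeZero n] (ρ μ : APString n) :
    ∑ ν, Complex.I ^ (Emat n μ ν - Emat n ρ ν) =
      2 ^ n * ((if ρ = μ then 1 else 0) - (if ρ = μ.flip then 1 else 0)) := by
  by_cases h1 : ρ = μ
  · subst h1
    simp [APString.flip_ne_self ρ |>.symm, APString.card]
  by_cases h2 : ρ = μ.flip
  · have h : ∀ ν, Complex.I ^ (Emat n μ ν - Emat n ρ ν) = -1 := fun ν => by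
      rw [h2, Emat_flip, sub_neg_eq_add, ← two_mul,
        Complex.I_zpow_two_mul_of_odd (odd_Emat μ ν)]
    rw [if_neg h1, if_pos h2]
    simp [h, APString.card]
  rw [if_neg h1, if_neg h2, sub_zero, mul_zero, ← self_eq_neg]
  obtain ⟨j, hj⟩ := exists_odd_sub_of_ne h1 h2
  rw [← Finset.sum_neg_distrib]
  refine Fintype.sum_equiv (APString.flipAt_involutive j).toPerm _ _ fun ν => ?_
  have hodd : Odd ((1 - 2 * ν.val j) *
      ((μ.val (j - 1) - μ.val j) - (ρ.val (j - 1) - ρ.val j))) :=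
    Odd.mul ⟨-ν.val j, by ring⟩ hj
  have hE : Emat n μ (ν.flipAt j) - Emat n ρ (ν.flipAt j) = (Emat n μ ν - Emat n ρ ν) +
      2 * ((1 - 2 * ν.val j) * ((μ.val (j - 1) - μ.val j) - (ρ.val (j - 1) - ρ.val j))) := by
    linear_combination Emat_flipAt_sub μ ν j - Emat_flipAt_sub ρ ν j
  rw [Function.Involutive.coe_toPerm, hE, zpow_add₀ Complex.I_ne_zero,
    Complex.I_zpow_two_mul_of_odd hodd]
  ring

theorem star_M2_mul_M2_apply {n : ℕ} [NeZero n] (ρ μ ν : APString n) :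
    star (M2 n ν ρ) * M2 n ν μ =
      (2 ^ (n + 1))⁻¹ * Complex.I ^ (Emat n μ ν - Emat n ρ ν) := by
  have hc : (2 : ℝ) ^ (-(((n : ℝ) + 1) / 2)) * (2 : ℝ) ^ (-(((n : ℝ) + 1) / 2)) =
      (2 ^ (n + 1))⁻¹ := by
    rw [← Real.rpow_add two_pos, ← neg_add, add_halves, Real.rpow_neg two_pos.le,
      ← Nat.cast_succ, Real.rpow_natCast]
  have hs : star (Complex.I ^ Emat n ρ ν) = (Complex.I ^ Emat n ρ ν)⁻¹ := by
    rw [star_zpow₀, Complex.star_def, Complex.conj_I, ← Complex.inv_I, _root_.inv_zpow]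
  have hc' := congrArg Complex.ofReal hc
  rw [Complex.ofReal_mul, Complex.ofReal_inv, Complex.ofReal_pow, Complex.ofReal_ofNat] at hc'
  simp only [M2, star_mul', hs, zpow_sub₀ Complex.I_ne_zero]
  rw [Complex.star_def, Complex.conj_ofReal, ← hc']
  ring

/-- Unitarity of `U₂₂` on the physical, flip-antisymmetric subspace:
`M₂† · M₂ = (1/2)(I − F)`. -/
theorem M2_conjTranspose_mul_M2 (n : ℕ) [NeZero n] :
    (M2 n)ᴴ * M2 n = (1 / 2 : ℂ) • (1 - flipMat n) := by
  ext ρ μ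
  have hflip : flipMat n ρ μ = if ρ = μ.flip then 1 else 0 := by
    simp only [flipMat, APString.flip, Subtype.ext_iff]
  simp only [Matrix.mul_apply, Matrix.conjTranspose_apply, star_M2_mul_M2_apply]
  rw [← Finset.mul_sum, sum_I_zpow_Emat_sub, Matrix.smul_apply, Matrix.sub_apply,
    Matrix.one_apply, hflip, smul_eq_mul, ← mul_assoc]
  congr 1
  field_simp
  ring
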